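/- Let J_1,…,J_7 be seven linear operators on ℝ⁸ that are skew-adjoint with respect to the standard inner product and satisfy J_α² = −Id and J_α J_β + J_β J_α = 0 for α ≠ β. Let ω_α be the alternating 2-form ω_α(X,Y) := ⟨J_α X, Y⟩ and let m be the linear span of {ω_1,…,ω_7}. Then the forms ω_1,…,ω_7 are linearly independent (so dim m = 7), and the linear map from alternating 3-forms on ℝ⁸ to linear maps ℝ⁸ → m, sending T to the map X ↦ proj_m(T(X,·,·)), is a linear isomorphism. -/

import Mathlib

open scoped BigOperators RealInnerProductSpace

noncomputable section

/-- `n`-dimensional Euclidean space. -/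
abbrev E (n : ℕ) := EuclideanSpace ℝ (Fin n)

/-- Alternating 2-forms on `ℝⁿ`. -/
abbrev Form2 (n : ℕ) := (E n) [⋀^Fin 2]→ₗ[ℝ] ℝ

/-- Alternating 3-forms on `ℝⁿ`. -/
abbrev Form3 (n : ℕ) := (E n) [⋀^Fin 3]→ₗ[ℝ] ℝ

/-- The standard orthonormal basis vectors of `ℝⁿ`. -/
def stdBasis {n : ℕ} (i : Fin n) : E n := EuclideanSpace.single i 1

/-- The inner product `⟨A,B⟩ = ∑_{i<j} A(e_i,e_j)·B(e_i,e_j)` on alternating 2-forms. -/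
def ip {n : ℕ} (A B : Form2 n) : ℝ :=
  ∑ i : Fin n, ∑ j : Fin n, if i < j then
    A ![stdBasis i, stdBasis j] * B ![stdBasis i, stdBasis j] else 0

/-- The contraction `(s ⌟ T)(X) = ∑_{i<j} s(e_i,e_j)·T(e_i,e_j,X)` of a 3-form by a 2-form. -/
def hook {n : ℕ} (s : Form2 n) (T : Form3 n) (X : E n) : ℝ :=
  ∑ i : Fin n, ∑ j : Fin n, if i < j then
    s ![stdBasis i, stdBasis j] * T ![stdBasis i, stdBasis j, X] else 0

/-- `IsOrthProj W p q` : `q` is the orthogonal projection (w.r.t. `ip`) of `p`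
onto the subspace `W` of alternating 2-forms. -/
def IsOrthProj {n : ℕ} (W : Submodule ℝ (Form2 n)) (p q : Form2 n) : Prop :=
  q ∈ W ∧ ∀ r ∈ W, ip (p - q) r = 0

lemma AlternatingMap.finset_sum_apply {R M N κ ι : Type*} [CommSemiring R] [AddCommMonoid M]
    [AddCommMonoid N] [Module R M] [Module R N] (s : Finset κ) (f : κ → M [⋀^ι]→ₗ[R] N)
    (m : ι → M) : (∑ k ∈ s, f k) m = ∑ k ∈ s, f k m :=
  map_sum (⟨⟨fun g => g m, rfl⟩, fun _ _ => rfl⟩ : (M [⋀^ι]→ₗ[R] N) →+ N) f s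

/-- Twice the inner product of two 2-forms is the sum of products of coefficients over all ordered
pairs of basis vectors. -/
lemma two_mul_ip {n : ℕ} (A B : Form2 n) :
    2 * ip A B = ∑ i : Fin n, ∑ j : Fin n,
      A ![stdBasis i, stdBasis j] * B ![stdBasis i, stdBasis j] := by
  have hswap (C : Form2 n) (x y : E n) : C ![y, x] = -C ![x, y] := by
    have h := C.map_swap ![x, y] (i := 0) (j := 1) (by decide)
    rw [← h]
    congr 1
    ext k : 1
    fin_cases k <;> simp
  have hdiag (C : Form2 n) (x : E n) : C ![x, x] = 0 :=
    C.map_eq_zero_of_eq ![x, x] (i := 0) (j := 1) rfl (by decide)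
  have hflip : ip A B = ∑ i : Fin n, ∑ j : Fin n, if j < i then
      A ![stdBasis i, stdBasis j] * B ![stdBasis i, stdBasis j] else 0 := by
    rw [ip, Finset.sum_comm]
    refine Finset.sum_congr rfl fun i _ => Finset.sum_congr rfl fun j _ => ?_
    rw [hswap A (stdBasis i), hswap B (stdBasis i), neg_mul_neg]
  rw [two_mul]
  nth_rw 1 [ip]
  rw [hflip, ← Finset.sum_add_distrib]
  refine Finset.sum_congr rfl fun i _ => ?_
  rw [← Finset.sum_add_distrib]
  refine Finset.sum_congr rfl fun j _ => ?_
  rcases lt_trichotomy i j with h | rfl | h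
  · simp [h, h.asymm]
  · simp [hdiag]
  · simp [h, h.asymm]

/-- `ip` as a linear map in its first argument. -/
def ipLeft {n : ℕ} (B : Form2 n) : Form2 n →ₗ[ℝ] ℝ where
  toFun A := ip A B
  map_add' A A' := by
    have h := two_mul_ip (A + A') B
    have h₁ := two_mul_ip A B
    have h₂ := two_mul_ip A' B
    simp only [AlternatingMap.add_apply, add_mul, Finset.sum_add_distrib] at h
    linarith
  map_smul' c A := by
    have h := two_mul_ip (c • A) B
    have h₁ := two_mul_ip A B
    simp only [AlternatingMap.smul_apply, smul_eq_mul, mul_assoc, ← Finset.mul_sum] at h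
    simp only [RingHom.id_apply, smul_eq_mul]
    linear_combination h / 2 - c * h₁ / 2

lemma ip_comm {n : ℕ} (A B : Form2 n) : ip A B = ip B A := by
  simp only [ip, mul_comm]

lemma isOrthProj_span_iff {n : ℕ} {ι : Type*} (ω : ι → Form2 n) (p q : Form2 n) :
    IsOrthProj (Submodule.span ℝ (Set.range ω)) p q ↔
      q ∈ Submodule.span ℝ (Set.range ω) ∧ ∀ α, ip p (ω α) = ip q (ω α) := by
  refine and_congr_right fun _ => ⟨fun h α => ?_, fun h r hr => ?_⟩
  · have h₁ := h (ω α) (Submodule.subset_span ⟨α, rfl⟩)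
    exact sub_eq_zero.1 (((ipLeft (ω α)).map_sub p q).symm.trans h₁)
  · suffices H : Submodule.span ℝ (Set.range ω) ≤ LinearMap.ker (ipLeft (p - q)) by
      rw [ip_comm]
      exact H hr
    rw [Submodule.span_le]
    rintro _ ⟨α, rfl⟩
    change ip (ω α) (p - q) = 0
    rw [ip_comm]
    exact ((ipLeft (ω α)).map_sub p q).trans (sub_eq_zero.2 (h α))

lemma sum_inner_stdBasis_mul {n : ℕ} (x y : E n) :
    ∑ i, ⟪x, stdBasis i⟫ * ⟪stdBasis i, y⟫ = ⟪x, y⟫ := by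
  simpa [stdBasis] using (EuclideanSpace.basisFun (Fin n) ℝ).sum_inner_mul_inner x y

/-- The inner product with the 2-form of an endomorphism is half a contraction with that
endomorphism. -/
lemma two_mul_ip_eq_sum_apply {n : ℕ} (A B : Form2 n) (K : E n →ₗ[ℝ] E n)
    (hB : ∀ X Y, B ![X, Y] = ⟪K X, Y⟫) :
    2 * ip A B = ∑ i, A ![stdBasis i, K (stdBasis i)] := by
  rw [two_mul_ip]
  refine Finset.sum_congr rfl fun i _ => ?_
  have hsum : ∑ j, ⟪stdBasis j, K (stdBasis i)⟫ • stdBasis j = K (stdBasis i) := by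
    simpa [stdBasis] using (EuclideanSpace.basisFun (Fin n) ℝ).sum_repr' (K (stdBasis i))
  have h := congrArg (A.curryLeft (stdBasis i)).toMultilinearMap.curryLeft hsum
  have h' := congrArg (fun f => f ![]) h
  simp only [map_sum, map_smul, sum_apply, smul_apply,
    MultilinearMap.curryLeft_apply, smul_eq_mul] at h'
  have hcons (y : E n) : (A.curryLeft (stdBasis i)).toMultilinearMap (Fin.cons y ![]) =
      A ![stdBasis i, y] := rfl
  simp only [hcons] at h'
  rw [← h']
  refine Finset.sum_congr rfl fun j _ => ?_
  rw [hB, real_inner_comm, mul_comm]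

lemma finrank_form3 (n : ℕ) : Module.finrank ℝ (Form3 n) = n.choose 3 := by
  rw [(exteriorPower.alternatingMapLinearEquiv (R := ℝ) (M := E n) (N := ℝ) (n := 3)).finrank_eq,
    Module.finrank_linearMap_self, exteriorPower.finrank_eq, finrank_euclideanSpace_fin]

instance (n : ℕ) : FiniteDimensional ℝ (Form3 n) :=
  Module.Finite.equiv
    (exteriorPower.alternatingMapLinearEquiv (R := ℝ) (M := E n) (N := ℝ) (n := 3)).symm

/-- The coefficients of the projected contractions of a 3-form with respect to 2-forms `ω α`. -/
def projCoeff {n : ℕ} {ι : Type*} (ω : ι → Form2 n) :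
    Form3 n →ₗ[ℝ] ι → Module.Dual ℝ (E n) :=
  LinearMap.pi fun α =>
    (LinearMap.compRight ℝ (ipLeft (ω α))) ∘ₗ AlternatingMap.curryLeftLinearMap

lemma projCoeff_apply {n : ℕ} {ι : Type*} (ω : ι → Form2 n) (T : Form3 n) (α : ι) (X : E n) :
    projCoeff ω T α X = ip (T.curryLeft X) (ω α) := rfl

/-- The 3-form `∑ v_β ∧ ω_β`. -/
def sumWedge {n : ℕ} {ι : Type*} [Fintype ι] (ω : ι → Form2 n) (v : ι → E n) : Form3 n :=
  AlternatingMap.alternatizeUncurryFin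
    (∑ β, (innerₛₗ ℝ (v β)).smulRight (ω β))

lemma sumWedge_apply {n : ℕ} {ι : Type*} [Fintype ι] (ω : ι → Form2 n) (v : ι → E n)
    (X Y Z : E n) :
    sumWedge ω v ![X, Y, Z] = ∑ β, (⟪v β, X⟫ * ω β ![Y, Z] - ⟪v β, Y⟫ * ω β ![X, Z]
      + ⟪v β, Z⟫ * ω β ![X, Y]) := by
  have h0 : Fin.removeNth 0 ![X, Y, Z] = ![Y, Z] := rfl
  have h1 : Fin.removeNth 1 ![X, Y, Z] = ![X, Z] := by ext k : 1; fin_cases k <;> rfl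
  have h2 : Fin.removeNth 2 ![X, Y, Z] = ![X, Y] := by ext k : 1; fin_cases k <;> rfl
  simp [sumWedge, AlternatingMap.alternatizeUncurryFin_apply, Fin.sum_univ_three, h0, h1, h2,
    LinearMap.sum_apply, AlternatingMap.finset_sum_apply, Finset.sum_add_distrib, sub_eq_add_neg]

section Clifford

variable {n : ℕ} {ι : Type*} {J : ι → (E n →ₗ[ℝ] E n)}

lemma inner_apply_apply_self (hskew : ∀ α (x y : E n), ⟪J α x, y⟫ = -⟪x, J α y⟫)
    (hinv : ∀ α (x : E n), J α (J α x) = -x) (α : ι) (x : E n) :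
    ⟪J α x, J α x⟫ = ⟪x, x⟫ := by
  rw [hskew, hinv, inner_neg_right, neg_neg]

lemma inner_apply_apply_of_ne (hskew : ∀ α (x y : E n), ⟪J α x, y⟫ = -⟪x, J α y⟫)
    (hanti : ∀ α β, α ≠ β → ∀ x : E n, J α (J β x) + J β (J α x) = 0)
    {α β : ι} (h : α ≠ β) (x : E n) : ⟪J α x, J β x⟫ = 0 := by
  have h₁ := hskew α x (J β x)
  have h₂ := hskew β x (J α x)
  have h₃ : ⟪x, J α (J β x) + J β (J α x)⟫ = 0 := by rw [hanti α β h, inner_zero_right]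
  rw [inner_add_right] at h₃
  rw [real_inner_comm] at h₂
  linarith

variable [Fintype ι]

lemma linearIndependent_of_clifford (hn : 0 < n)
    (hskew : ∀ α (x y : E n), ⟪J α x, y⟫ = -⟪x, J α y⟫)
    (hinv : ∀ α (x : E n), J α (J α x) = -x)
    (hanti : ∀ α β, α ≠ β → ∀ x : E n, J α (J β x) + J β (J α x) = 0)
    {ω : ι → Form2 n} (hω : ∀ α (X Y : E n), ω α ![X, Y] = ⟪J α X, Y⟫) :
    LinearIndependent ℝ ω := by
  rw [Fintype.linearIndependent_iff]
  intro c hc α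
  let e : E n := stdBasis ⟨0, hn⟩
  have h := congrArg (fun A : Form2 n => A ![e, J α e]) hc
  simp only [AlternatingMap.finset_sum_apply, AlternatingMap.smul_apply, hω, smul_eq_mul,
    AlternatingMap.zero_apply] at h
  rw [Finset.sum_eq_single α (fun β _ hβ => by
    rw [inner_apply_apply_of_ne hskew hanti hβ, mul_zero]) (by simp),
    inner_apply_apply_self hskew hinv] at h
  simpa [e, stdBasis] using h

variable [DecidableEq ι]

lemma sum_apply_apply (hinv : ∀ α (x : E n), J α (J α x) = -x)
    (hanti : ∀ α β, α ≠ β → ∀ x : E n, J α (J β x) + J β (J α x) = 0)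
    (v : ι → E n) (α : ι) :
    ∑ β, J β (J α (v β)) = -J α (∑ β, J β (v β)) - (2 : ℝ) • v α := by
  have h (β : ι) : J β (J α (v β)) = -J α (J β (v β)) - if α = β then (2 : ℝ) • v β else 0 := by
    split_ifs with hαβ
    · subst hαβ
      rw [hinv, two_smul]
      abel
    · rw [sub_zero]
      exact eq_neg_of_add_eq_zero_right (hanti α β hαβ (v β))
  rw [Finset.sum_congr rfl fun β _ => h β]
  simp [map_sum, Finset.sum_sub_distrib]

lemma projCoeff_sumWedge (hskew : ∀ α (x y : E n), ⟪J α x, y⟫ = -⟪x, J α y⟫)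
    (hinv : ∀ α (x : E n), J α (J α x) = -x)
    (hanti : ∀ α β, α ≠ β → ∀ x : E n, J α (J β x) + J β (J α x) = 0)
    {ω : ι → Form2 n} (hω : ∀ α (X Y : E n), ω α ![X, Y] = ⟪J α X, Y⟫)
    (v : ι → E n) (α : ι) (X : E n) :
    projCoeff ω (sumWedge ω v) α X =
      ⟪((n : ℝ) / 2 - 2) • v α - J α (∑ β, J β (v β)), X⟫ := by
  have key (β : ι) : ∑ i, (⟪v β, X⟫ * ⟪J β (stdBasis i), J α (stdBasis i)⟫
      - ⟪v β, stdBasis i⟫ * ⟪J β X, J α (stdBasis i)⟫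
      + ⟪v β, J α (stdBasis i)⟫ * ⟪J β X, stdBasis i⟫) =
      (if α = β then n * ⟪v β, X⟫ else 0) + 2 * ⟪J β (J α (v β)), X⟫ := by
    have h₁ : ∑ i, ⟪J β (stdBasis i), J α (stdBasis i)⟫ = if α = β then (n : ℝ) else 0 := by
      split_ifs with h
      · subst h
        simp only [inner_apply_apply_self hskew hinv]
        simp [stdBasis]
      · exact Finset.sum_eq_zero fun i _ =>
          inner_apply_apply_of_ne hskew hanti (Ne.symm h) _
    have h₂ : ∑ i, ⟪v β, stdBasis i⟫ * ⟪J β X, J α (stdBasis i)⟫ = -⟪J β (J α (v β)), X⟫ := by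
      have h (i : Fin n) : ⟪J β X, J α (stdBasis i)⟫ = -⟪stdBasis i, J α (J β X)⟫ := by
        rw [real_inner_comm, hskew]
      simp only [h, mul_neg, Finset.sum_neg_distrib, sum_inner_stdBasis_mul]
      rw [hskew β, hskew α]
      ring
    have h₃ : ∑ i, ⟪v β, J α (stdBasis i)⟫ * ⟪J β X, stdBasis i⟫ = ⟪J β (J α (v β)), X⟫ := by
      have h (i : Fin n) : ⟪v β, J α (stdBasis i)⟫ = -⟪J α (v β), stdBasis i⟫ := by
        rw [hskew, neg_neg]
      simp only [h, real_inner_comm (stdBasis _) (J β X), neg_mul, Finset.sum_neg_distrib,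
        sum_inner_stdBasis_mul]
      rw [hskew β]
    rw [Finset.sum_add_distrib, Finset.sum_sub_distrib, ← Finset.mul_sum, h₁, h₂, h₃]
    split_ifs <;> ring
  have hcurry (Y Z : E n) : (sumWedge ω v).curryLeft X ![Y, Z] = sumWedge ω v ![X, Y, Z] := rfl
  have h := two_mul_ip_eq_sum_apply ((sumWedge ω v).curryLeft X) (ω α) (J α) (hω α)
  simp only [hcurry, sumWedge_apply, hω] at h
  rw [Finset.sum_comm, Finset.sum_congr rfl fun β _ => key β, Finset.sum_add_distrib,
    ← Finset.mul_sum, ← sum_inner, sum_apply_apply hinv hanti] at h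
  simp only [Finset.sum_ite_eq, Finset.mem_univ, if_true, inner_sub_left, inner_neg_left,
    real_inner_smul_left] at h
  rw [projCoeff_apply, inner_sub_left, real_inner_smul_left]
  linear_combination h / 2

end Clifford

lemma projCoeff_bijective {J : Fin 7 → (E 8 →ₗ[ℝ] E 8)}
    (hskew : ∀ α (x y : E 8), ⟪J α x, y⟫ = -⟪x, J α y⟫)
    (hinv : ∀ α (x : E 8), J α (J α x) = -x)
    (hanti : ∀ α β, α ≠ β → ∀ x : E 8, J α (J β x) + J β (J α x) = 0)
    {ω : Fin 7 → Form2 8} (hω : ∀ α (X Y : E 8), ω α ![X, Y] = ⟪J α X, Y⟫) :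
    Function.Bijective (projCoeff ω) := by
  have hsurj : Function.Surjective (projCoeff ω) := by
    intro f
    let t : Fin 7 → E 8 := fun α =>
      (InnerProductSpace.toDual ℝ (E 8)).symm (f α).toContinuousLinearMap
    have ht (α : Fin 7) (X : E 8) : ⟪t α, X⟫ = f α X := by simp [t]
    let w : E 8 := (1 / 9 : ℝ) • ∑ α, J α (t α)
    let v : Fin 7 → E 8 := fun α => (1 / 2 : ℝ) • (t α + J α w)
    have hw : ∑ β, J β (v β) = w := by
      have h9 : ∑ α, J α (t α) = (9 : ℝ) • w := by simp [w, smul_smul]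
      simp only [v, map_smul, map_add, hinv, ← Finset.smul_sum, Finset.sum_add_distrib, h9]
      simp only [Finset.sum_const, Finset.card_univ, Fintype.card_fin]
      module
    refine ⟨sumWedge ω v, ?_⟩
    ext1 α
    refine LinearMap.ext fun X => ?_
    rw [projCoeff_sumWedge hskew hinv hanti hω, hw, ← ht]
    congr 1
    simp only [v]
    push_cast
    module
  refine ⟨?_, hsurj⟩
  refine (LinearMap.injective_iff_surjective_of_finrank_eq_finrank ?_).2 hsurj
  rw [finrank_form3, Module.finrank_pi_fintype]
  simp [Subspace.dual_finrank_eq, Nat.choose]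

/-- Example 5.3 of the paper: `Λ³(ℝ⁸) ≅ ℝ⁸ ⊗ m` for Spin(7).
For seven skew-adjoint anticommuting complex structures `J₁,…,J₇` on `ℝ⁸`, the 2-forms
`ω_α(X,Y) = ⟨J_α X, Y⟩` are linearly independent (so `m = span{ω₁,…,ω₇}` is
7-dimensional), and the map sending an alternating 3-form `T` to the linear map
`X ↦ proj_m(T(X,·,·))` is a linear isomorphism onto the space of linear maps `ℝ⁸ → m`:
every linear map into `m` is the projected contraction of a unique 3-form. -/
theorem stmt_10 (J : Fin 7 → (E 8 →ₗ[ℝ] E 8))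
    (hskew : ∀ α (x y : E 8), ⟪J α x, y⟫ = -⟪x, J α y⟫)
    (hinv : ∀ α (x : E 8), J α (J α x) = -x)
    (hanti : ∀ α β, α ≠ β → ∀ x : E 8, J α (J β x) + J β (J α x) = 0)
    (ω : Fin 7 → Form2 8)
    (hω : ∀ α (X Y : E 8), ω α ![X, Y] = ⟪J α X, Y⟫) :
    LinearIndependent ℝ ω ∧
    Module.finrank ℝ (Submodule.span ℝ (Set.range ω)) = 7 ∧
    ∀ Γ : E 8 →ₗ[ℝ] Form2 8, (∀ X, Γ X ∈ Submodule.span ℝ (Set.range ω)) →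
      ∃! T : Form3 8, ∀ X,
        IsOrthProj (Submodule.span ℝ (Set.range ω)) (T.curryLeft X) (Γ X) := by
  have hli := linearIndependent_of_clifford (by norm_num) hskew hinv hanti hω
  refine ⟨hli, by rw [finrank_span_eq_card hli, Fintype.card_fin], fun Γ hΓ => ?_⟩
  have hiff (T : Form3 8) :
      (∀ X, IsOrthProj (Submodule.span ℝ (Set.range ω)) (T.curryLeft X) (Γ X)) ↔
        projCoeff ω T = fun α => ipLeft (ω α) ∘ₗ Γ := by
    simp only [isOrthProj_span_iff, hΓ, true_and, funext_iff, LinearMap.ext_iff]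
    exact forall_comm
  simp only [hiff]
  exact (projCoeff_bijective hskew hinv hanti hω).existsUnique _
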